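/- If an extended word equation (U₁,U₂,<) is incoherent, then there is an incoherent core such that no cover in it impinges on another cover in it. -/

import Mathlib

open scoped Classical

namespace ExtWordEq

/-- The type of (candidate) boundary orders: relations on pairs (i,j). -/
abbrev BRel : Type := ℕ × ℕ → ℕ × ℕ → Prop

variable {X : Type*}

/-- The `i`-th side of the word equation (`i = 1` gives `U₁`, anything else `U₂`). -/
def word (U₁ U₂ : List X) (i : ℕ) : List X := if i = 1 then U₁ else U₂

/-- The variable `U_{i,j}` (1-indexed), as an optional value. -/
def letter (U₁ U₂ : List X) (b : ℕ × ℕ) : Option X := (word U₁ U₂ b.1)[b.2 - 1]?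

/-- `b` is a boundary of the word equation `(U₁, U₂)`. -/
def Boundary (U₁ U₂ : List X) (b : ℕ × ℕ) : Prop :=
  (b.1 = 1 ∨ b.1 = 2) ∧ 1 ≤ b.2 ∧ b.2 ≤ (word U₁ U₂ b.1).length

/-- `b` is a boundary of `(U₁, U₂)` or one of the conventional boundaries `(1,0)`, `(2,0)`. -/
def EBoundary (U₁ U₂ : List X) (b : ℕ × ℕ) : Prop :=
  (b.1 = 1 ∨ b.1 = 2) ∧ b.2 ≤ (word U₁ U₂ b.1).length

/-- Incomparability `a ≈ b` for a strict order. -/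
def Incomp (lt : BRel) (a b : ℕ × ℕ) : Prop := ¬ lt a b ∧ ¬ lt b a

/-- `lt` is a boundary order for the word equation `(U₁, U₂)`:
a strict weak order on the boundaries (together with the conventional boundaries
`(1,0) ≈ (2,0)`), extending `(i,j) < (i,j+1)` and with `(1,m) ≈ (2,n)`. -/
structure BoundaryOrder (U₁ U₂ : List X) (lt : BRel) : Prop where
  irrefl : ∀ a, EBoundary U₁ U₂ a → ¬ lt a a
  trans : ∀ a b c, EBoundary U₁ U₂ a → EBoundary U₁ U₂ b → EBoundary U₁ U₂ c →
    lt a b → lt b c → lt a c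
  incomp_trans : ∀ a b c, EBoundary U₁ U₂ a → EBoundary U₁ U₂ b → EBoundary U₁ U₂ c →
    Incomp lt a b → Incomp lt b c → Incomp lt a c
  succ : ∀ i j : ℕ, EBoundary U₁ U₂ (i, j + 1) → lt (i, j) (i, j + 1)
  top : Incomp lt (1, U₁.length) (2, U₂.length)
  bot : Incomp lt (1, 0) (2, 0)

/-- `L(U_{i,1} U_{i,2} ⋯ U_{i,j})` where `L` is the additive extension of a length
assignment on variables. -/
def prefixLen (U₁ U₂ : List X) (L : X → ℕ) (b : ℕ × ℕ) : ℕ :=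
  (((word U₁ U₂ b.1).take b.2).map L).sum

/-- The extended word equation `(U₁, U₂, lt)` is coherent. -/
def Coherent (U₁ U₂ : List X) (lt : BRel) : Prop :=
  ∃ L : X → ℕ, (∀ x, 0 < L x) ∧
    ∀ a b, Boundary U₁ U₂ a → Boundary U₁ U₂ b →
      (lt a b ↔ prefixLen U₁ U₂ L a < prefixLen U₁ U₂ L b)

/-- The boundary `a` cuts the boundary `b`. -/
def Cuts (U₁ U₂ : List X) (lt : BRel) (a b : ℕ × ℕ) : Prop :=
  Boundary U₁ U₂ a ∧ Boundary U₁ U₂ b ∧ a ≠ b ∧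
    lt (a.1, a.2 - 1) b ∧ lt (b.1, b.2 - 1) a

/-- The boundary `a` mirrors the boundary `b`. -/
def Mirrors (U₁ U₂ : List X) (lt : BRel) (a b : ℕ × ℕ) : Prop :=
  Boundary U₁ U₂ a ∧ Boundary U₁ U₂ b ∧ letter U₁ U₂ a = letter U₁ U₂ b ∧
    (¬ Incomp lt a b ∨ ¬ Incomp lt (a.1, a.2 - 1) (b.1, b.2 - 1))

/-- Edge relation of the cut graph `G_{U₁,U₂,<}`. -/
def CutEdge (U₁ U₂ : List X) (lt : BRel) (a b : ℕ × ℕ) : Prop :=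
  ∃ c, Cuts U₁ U₂ lt a c ∧ Mirrors U₁ U₂ lt c b

/-- `w 0, w 1, …, w n` is a cycle (of length `n ≥ 1`) in the cut graph. -/
def IsCycle (U₁ U₂ : List X) (lt : BRel) (n : ℕ) (w : ℕ → ℕ × ℕ) : Prop :=
  0 < n ∧ w n = w 0 ∧ ∀ k < n, CutEdge U₁ U₂ lt (w k) (w (k + 1))

/-- The cut graph `G_{U₁,U₂,<}` is acyclic. -/
def Acyclic (U₁ U₂ : List X) (lt : BRel) : Prop :=
  ¬ ∃ n w, IsCycle U₁ U₂ lt n w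

variable [DecidableEq X]

/-- Case I extended Nielsen transformation (here `x = U_{1,1}`, `y = U_{2,1}`,
and `T(y) = x`). -/
def NielsenI (U₁ U₂ : List X) (lt : BRel) (U₁' U₂' : List X) (lt' : BRel) : Prop :=
  ∃ x y : X, U₁.head? = some x ∧ U₂.head? = some y ∧
    Incomp lt (1, 1) (2, 1) ∧
    U₁' = (U₁.map fun z => if z = y then x else z).tail ∧
    U₂' = (U₂.map fun z => if z = y then x else z).tail ∧
    BoundaryOrder U₁' U₂' lt' ∧
    ∀ a b : ℕ × ℕ, EBoundary U₁' U₂' a → EBoundary U₁' U₂' b →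
      (lt' a b ↔ lt (a.1, a.2 + 1) (b.1, b.2 + 1))

/-- The substitution `T(x) = y x` (identity on other variables), applied to a word. -/
def expand (x y : X) (l : List X) : List X :=
  l.flatMap fun z => if z = x then [y, x] else [z]

/-- The map `μ(i,j) = j + #{j' ≤ j : U_{i,j'} = x} − 1` (as a map on boundaries),
where `x = U_{1,1}`. -/
def mu (U₁ U₂ : List X) (x : X) (b : ℕ × ℕ) : ℕ × ℕ :=
  (b.1, b.2 + ((word U₁ U₂ b.1).take b.2).count x - 1)

/-- The map `ν(i,j) = j − #{j' ≤ j : U'_{i,j'} = x} + 1` (as a map on boundaries),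
where `x = U_{1,1}`. -/
def nu (U₁' U₂' : List X) (x : X) (b : ℕ × ℕ) : ℕ × ℕ :=
  (b.1, b.2 - ((word U₁' U₂' b.1).take b.2).count x + 1)

/-- Membership in `B⁻ = B ∖ {(2,1)}`. -/
def Bminus (U₁ U₂ : List X) (b : ℕ × ℕ) : Prop := Boundary U₁ U₂ b ∧ b ≠ (2, 1)

/-- Membership in `B'⁻ = {(i, μ(i,j)) : (i,j) ∈ B⁻}` (`x = U_{1,1}`). -/
def Bpminus (U₁ U₂ : List X) (x : X) (b' : ℕ × ℕ) : Prop :=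
  ∃ b, Bminus U₁ U₂ b ∧ mu U₁ U₂ x b = b'

/-- Case II extended Nielsen transformation, with the heads `x = U_{1,1}`,
`y = U_{2,1}` made explicit. -/
def NielsenIIxy (U₁ U₂ : List X) (lt : BRel) (U₁' U₂' : List X) (lt' : BRel)
    (x y : X) : Prop :=
  U₁.head? = some x ∧ U₂.head? = some y ∧
  lt (2, 1) (1, 1) ∧
  U₁' = (expand x y U₁).tail ∧
  U₂' = (expand x y U₂).tail ∧
  BoundaryOrder U₁' U₂' lt' ∧
  ∀ a b, Bpminus U₁ U₂ x a → Bpminus U₁ U₂ x b →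
    (lt' a b ↔ lt (nu U₁' U₂' x a) (nu U₁' U₂' x b))

/-- Case II extended Nielsen transformation. -/
def NielsenII (U₁ U₂ : List X) (lt : BRel) (U₁' U₂' : List X) (lt' : BRel) : Prop :=
  ∃ x y : X, NielsenIIxy U₁ U₂ lt U₁' U₂' lt' x y

/-- The dual boundary order. -/
def dualRel (lt : BRel) : BRel := fun a b => lt (3 - a.1, a.2) (3 - b.1, b.2)

/-- Case III extended Nielsen transformation: case II applied to the dual,
then dualized back. -/
def NielsenIII (U₁ U₂ : List X) (lt : BRel) (U₁' U₂' : List X) (lt' : BRel) : Prop :=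
  NielsenII U₂ U₁ (dualRel lt) U₂' U₁' (dualRel lt')

/-- `(U₁', U₂', lt')` is an extended Nielsen transformation of the nontrivial coherent
extended word equation `(U₁, U₂, lt)`. -/
def ExtNielsen (U₁ U₂ : List X) (lt : BRel) (U₁' U₂' : List X) (lt' : BRel) : Prop :=
  U₁ ≠ [] ∧ U₂ ≠ [] ∧ BoundaryOrder U₁ U₂ lt ∧ Coherent U₁ U₂ lt ∧
    (NielsenI U₁ U₂ lt U₁' U₂' lt' ∨ NielsenII U₁ U₂ lt U₁' U₂' lt' ∨
      NielsenIII U₁ U₂ lt U₁' U₂' lt')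

/-- A coherent extended Nielsen transformation. -/
def CohNielsen (U₁ U₂ : List X) (lt : BRel) (U₁' U₂' : List X) (lt' : BRel) : Prop :=
  ExtNielsen U₁ U₂ lt U₁' U₂' lt' ∧ Coherent U₁' U₂' lt'

/-- `(U₁, U₂, lt)` is (strongly) terminating: there is no infinite sequence of coherent
extended Nielsen transformations starting from it. -/
def Terminating (U₁ U₂ : List X) (lt : BRel) : Prop :=
  ¬ ∃ f : ℕ → List X × List X × BRel,
    f 0 = (U₁, U₂, lt) ∧
    ∀ n, CohNielsen (f n).1 (f n).2.1 (f n).2.2 (f (n + 1)).1 (f (n + 1)).2.1 (f (n + 1)).2.2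


/-- An interval of boundaries `⟨i,[j,k]⟩ = {(i,ℓ) : j ≤ ℓ ≤ k}`. -/
structure Seg where
  i : ℕ
  j : ℕ
  k : ℕ
deriving DecidableEq

/-- `s` is a valid (possibly empty) interval of boundaries of `(U₁,U₂)`. -/
def ValidSeg (U₁ U₂ : List X) (s : Seg) : Prop :=
  (s.i = 1 ∨ s.i = 2) ∧ 1 ≤ s.j ∧ s.j ≤ s.k + 1 ∧ s.k ≤ (word U₁ U₂ s.i).length

/-- `a ≲ b`, i.e. `a < b` or `a ≈ b`. -/
def LeS (lt : BRel) (a b : ℕ × ℕ) : Prop := lt a b ∨ Incomp lt a b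

/-- `(A, B)` is a cover: `A` and `B` are intervals on opposite sides with
`(B.i, B.j−1) ≲ (A.i, A.j−1)` and `(A.i, A.k) ≲ (B.i, B.k)`. -/
def IsCover (U₁ U₂ : List X) (lt : BRel) (A B : Seg) : Prop :=
  ValidSeg U₁ U₂ A ∧ ValidSeg U₁ U₂ B ∧ A.i ≠ B.i ∧
    LeS lt (B.i, B.j - 1) (A.i, A.j - 1) ∧ LeS lt (A.i, A.k) (B.i, B.k)

/-- `(A, B)` is a strict cover: a cover for which at least one of the two defining
inequalities is strict. -/
def IsStrictCover (U₁ U₂ : List X) (lt : BRel) (A B : Seg) : Prop :=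
  IsCover U₁ U₂ lt A B ∧ (lt (B.i, B.j - 1) (A.i, A.j - 1) ∨ lt (A.i, A.k) (B.i, B.k))

/-- The list of variables `U_{i,j} U_{i,j+1} ⋯ U_{i,k}` of the interval `s`. -/
def segList (U₁ U₂ : List X) (s : Seg) : List X :=
  ((word U₁ U₂ s.i).take s.k).drop (s.j - 1)

/-- `L(U_{⟨i,[j,k]⟩})`, the value of the additive extension of `L` on an interval. -/
def segL (U₁ U₂ : List X) (L : X → ℕ) (s : Seg) : ℕ := ((segList U₁ U₂ s).map L).sum

/-- `U_{⟨i,[j,k]⟩} = Σ_{ℓ=j}^{k} U_{i,ℓ}` as an element of `ℕ[𝒳]`,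
the free commutative monoid on `X` (realized as `X →₀ ℕ`). -/
noncomputable def segSum (U₁ U₂ : List X) (s : Seg) : X →₀ ℕ :=
  ((segList U₁ U₂ s).map fun a => Finsupp.single a 1).sum

/-- A set `C` of covers is an incoherent core: the associated system of inequalities
(non-strict for covers, strict for strict covers) has no solution over `ℤ_{>0}`. -/
def IncoherentCore (U₁ U₂ : List X) (lt : BRel) (C : Set (Seg × Seg)) : Prop :=
  (∀ p ∈ C, IsCover U₁ U₂ lt p.1 p.2) ∧
  ¬ ∃ L : X → ℕ, (∀ x, 0 < L x) ∧
    (∀ p ∈ C, segL U₁ U₂ L p.1 ≤ segL U₁ U₂ L p.2) ∧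
    (∀ p ∈ C, IsStrictCover U₁ U₂ lt p.1 p.2 → segL U₁ U₂ L p.1 < segL U₁ U₂ L p.2)

/-- The boundary `b` lies in the interval `s`. -/
def InSeg (s : Seg) (b : ℕ × ℕ) : Prop := b.1 = s.i ∧ s.j ≤ b.2 ∧ b.2 ≤ s.k

/-- The cover `p` impinges on the cover `q`: `B₁ ∩ A₂ ≠ ∅`. -/
def Impinges (p q : Seg × Seg) : Prop := ∃ b, InSeg p.2 b ∧ InSeg q.1 b

/-- Boundaries `a` and `b` are twins. -/
def Twins (U₁ U₂ : List X) (lt : BRel) (a b : ℕ × ℕ) : Prop :=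
  Boundary U₁ U₂ a ∧ Boundary U₁ U₂ b ∧ letter U₁ U₂ a = letter U₁ U₂ b ∧
    a ≠ b ∧ Incomp lt a b ∧ Incomp lt (a.1, a.2 - 1) (b.1, b.2 - 1)

/-- The cover `p` is twin-free: neither of its intervals contains a twin. -/
def TwinFree (U₁ U₂ : List X) (lt : BRel) (p : Seg × Seg) : Prop :=
  (∀ a, InSeg p.1 a → ¬ ∃ b, Twins U₁ U₂ lt a b) ∧
  (∀ a, InSeg p.2 a → ¬ ∃ b, Twins U₁ U₂ lt a b)

/-- **Gordan's alternative** over `ℚ`: finitely many linear functionals are either simultaneously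
positive at some vector, or satisfy a nontrivial relation with nonnegative coefficients. -/
theorem gordan_alternative {n : ℕ} {V : Type*} [AddCommGroup V] [Module ℚ V]
    (φ : Fin n → V →ₗ[ℚ] ℚ) :
    (∃ v, ∀ i, 0 < φ i v) ∨
      ∃ c : Fin n → ℚ, (∀ i, 0 ≤ c i) ∧ (∃ i, 0 < c i) ∧ ∀ v, ∑ i, c i * φ i v = 0 := by
  induction n generalizing V with
  | zero => exact Or.inl ⟨0, fun i => i.elim0⟩
  | succ n ih =>
    by_cases hψ : ∀ v, φ 0 v = 0
    · refine Or.inr ⟨Pi.single 0 1, fun i => ?_, ⟨0, by simp⟩, fun v => ?_⟩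
      · by_cases h : i = 0
        · subst h; simp
        · simp [h]
      · simp [Fin.sum_univ_succ, hψ]
    push Not at hψ
    obtain ⟨u₀, hu₀⟩ := hψ
    obtain ⟨u, hu⟩ : ∃ u, φ 0 u = 1 := ⟨(φ 0 u₀)⁻¹ • u₀, by simp [hu₀]⟩
    rcases ih (fun i => (φ i.succ).comp (LinearMap.ker (φ 0)).subtype) with
      ⟨w, hw⟩ | ⟨c, hc, ⟨i₀, hi₀⟩, hsum⟩
    · left
      have key : ∀ i : Fin n, ∀ᶠ N : ℕ in Filter.atTop,
          0 < (N : ℚ) * φ i.succ w + φ i.succ u := by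
        intro i
        have hpos : 0 < φ i.succ w := hw i
        have : Filter.Tendsto (fun N : ℕ => (N : ℚ) * φ i.succ w + φ i.succ u)
            Filter.atTop Filter.atTop :=
          Filter.tendsto_atTop_add_const_right _ _
            (tendsto_natCast_atTop_atTop.atTop_mul_const hpos)
        exact this.eventually_gt_atTop 0
      obtain ⟨N, hN⟩ := (Filter.eventually_all.2 key).exists
      refine ⟨(N : ℚ) • (w : V) + u, fun i => ?_⟩
      refine Fin.cases ?_ (fun i => ?_) i
      · have : φ 0 (w : V) = 0 := w.2
        simp [this, hu]
      · simpa using hN i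
    · have hlin : ∀ v, ∑ i, c i * φ i.succ v = (∑ i, c i * φ i.succ u) * φ 0 v := by
        intro v
        have hmem : v - φ 0 v • u ∈ LinearMap.ker (φ 0) := by simp [hu]
        have h := hsum ⟨_, hmem⟩
        simp only [LinearMap.comp_apply, Submodule.subtype_apply, map_sub, map_smul,
          smul_eq_mul, mul_sub, Finset.sum_sub_distrib] at h
        rw [sub_eq_zero.1 h, Finset.sum_mul]
        exact Finset.sum_congr rfl fun i _ => by ring
      set lam := ∑ i, c i * φ i.succ u with hlam
      rcases le_or_gt lam 0 with hle | hgt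
      · right
        refine ⟨Fin.cons (-lam) c, fun i => ?_, ⟨i₀.succ, by simpa using hi₀⟩, fun v => ?_⟩
        · refine Fin.cases ?_ (fun i => ?_) i
          · simpa using hle
          · simpa using hc i
        · rw [Fin.sum_univ_succ]
          simp only [Fin.cons_zero, Fin.cons_succ, hlin]
          ring
      · rcases ih (fun i => φ i.succ) with ⟨v, hv⟩ | ⟨d, hd, ⟨i₁, hi₁⟩, hdsum⟩
        · left
          refine ⟨v, fun i => Fin.cases ?_ (fun i => hv i) i⟩
          have h1 : 0 < ∑ i, c i * φ i.succ v :=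
            Finset.sum_pos' (fun i _ => mul_nonneg (hc i) (hv i).le)
              ⟨i₀, Finset.mem_univ _, mul_pos hi₀ (hv i₀)⟩
          rw [hlin] at h1
          exact pos_of_mul_pos_right h1 hgt.le
        · right
          refine ⟨Fin.cons 0 d, fun i => ?_, ⟨i₁.succ, by simpa using hi₁⟩, fun v => ?_⟩
          · refine Fin.cases ?_ (fun i => ?_) i
            · simp
            · simpa using hd i
          · rw [Fin.sum_univ_succ]
            simpa using hdsum v

/-- Gordan's alternative with additional linear equations. -/
theorem gordan_alternative_of_eq {n : ℕ} {κ V : Type*} [Fintype κ] [AddCommGroup V] [Module ℚ V]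
    (φ : Fin n → V →ₗ[ℚ] ℚ) (χ : κ → V →ₗ[ℚ] ℚ) :
    (∃ v, (∀ i, 0 < φ i v) ∧ ∀ k, χ k v = 0) ∨
      ∃ (c : Fin n → ℚ) (d : κ → ℚ), (∀ i, 0 ≤ c i) ∧ (∃ i, 0 < c i) ∧
        ∀ v, ∑ i, c i * φ i v = ∑ k, d k * χ k v := by
  rcases gordan_alternative
      (fun i => (φ i).comp (⨅ k, LinearMap.ker (χ k)).subtype) with ⟨v, hv⟩ | ⟨c, hc, hpos, hsum⟩
  · refine Or.inl ⟨v, hv, fun k => ?_⟩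
    have := v.2
    rw [Submodule.mem_iInf] at this
    exact this k
  · right
    have hmem : (∑ i, c i • φ i) ∈ Submodule.span ℚ (Set.range χ) := by
      refine mem_span_of_iInf_ker_le_ker fun v hv => ?_
      simpa using hsum ⟨v, hv⟩
    obtain ⟨d, hd⟩ := (Submodule.mem_span_range_iff_exists_fun ℚ).1 hmem
    refine ⟨c, d, hc, hpos, fun v => ?_⟩
    simpa using (LinearMap.congr_fun hd v).symm

/-- Finitely many rationals have a common positive denominator. -/
theorem exists_common_denominator {ι : Type*} (s : Finset ι) (f : ι → ℚ) :
    ∃ N : ℕ, 0 < N ∧ ∀ i ∈ s, ∃ z : ℤ, (N : ℚ) * f i = z := by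
  refine ⟨∏ i ∈ s, (f i).den, Finset.prod_pos fun i _ => (f i).den_pos, fun i hi => ?_⟩
  refine ⟨(∏ j ∈ s.erase i, (f j).den : ℕ) * (f i).num, ?_⟩
  rw [← Finset.mul_prod_erase s _ hi]
  push_cast
  have : (f i) * (f i).den = (f i).num := Rat.mul_den_eq_num _
  linear_combination (∏ j ∈ s.erase i, ((f j).den : ℚ)) * this

/-- The `j`-th step of `p` and the `k`-th step of `q` have a common cell. -/
def Overlap (p q : ℕ → ℕ) (j k : ℕ) : Prop := p j < q (k + 1) ∧ q k < p (j + 1)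

theorem Overlap.symm {p q : ℕ → ℕ} {j k : ℕ} (h : Overlap p q j k) : Overlap q p k j :=
  ⟨h.2, h.1⟩

theorem exists_step_of_mem {p : ℕ → ℕ} {m t : ℕ} (h0 : p 0 ≤ t) (hm : t < p m) :
    ∃ j < m, p j ≤ t ∧ t < p (j + 1) := by
  induction m with
  | zero => omega
  | succ m ih =>
    by_cases h : t < p m
    · obtain ⟨j, hj, h'⟩ := ih h
      exact ⟨j, by omega, h'⟩
    · exact ⟨m, by omega, by omega, hm⟩

theorem sum_step_single {p : ℕ → ℕ} {m : ℕ} (hp : StrictMonoOn p (Set.Iic m)) (f : ℕ → ℚ)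
    {j t : ℕ} (hj : j < m) (h1 : p j ≤ t) (h2 : t < p (j + 1)) :
    ∑ i ∈ Finset.range m, f i * ∑ s ∈ Finset.Ico (p i) (p (i + 1)), (Pi.single t 1 : ℕ → ℚ) s
      = f j := by
  rw [Finset.sum_eq_single j]
  · rw [Finset.sum_pi_single']
    simp [h1, h2]
  · intro i hi hij
    rw [Finset.sum_pi_single']
    have hi := Finset.mem_range.1 hi
    have : ¬ (p i ≤ t ∧ t < p (i + 1)) := by
      rintro ⟨h3, h4⟩
      rcases lt_or_gt_of_ne hij with h | h
      · have := hp.monotoneOn (a := i + 1) (b := j) (by simp; omega) (by simp; omega) (by omega)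
        omega
      · have := hp.monotoneOn (a := j + 1) (b := i) (by simp; omega) (by simp; omega) (by omega)
        omega
    simp [this]
  · intro h; simp at h; omega

/-- Either the two subdivisions admit a positive weighting of the cells for which every step
has its prescribed weight, or this is obstructed by integer step functions. -/
theorem weights_or_certificate {Λ : Type*} [AddCommGroup Λ] [Module ℚ Λ] {p q : ℕ → ℕ} {m n : ℕ}
    (hp : StrictMonoOn p (Set.Iic m)) (hq : StrictMonoOn q (Set.Iic n))
    (h0 : p 0 = q 0) (hmn : p m = q n) (α β : ℕ → Λ →ₗ[ℚ] ℚ) :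
    (∃ (L : Λ) (w : ℕ → ℚ), (∀ t < p m, 0 < w t) ∧
      (∀ j < m, ∑ t ∈ Finset.Ico (p j) (p (j + 1)), w t = α j L) ∧
      (∀ k < n, ∑ t ∈ Finset.Ico (q k) (q (k + 1)), w t = β k L)) ∨
    ∃ f g : ℕ → ℤ,
      (∀ L, ∑ j ∈ Finset.range m, (f j : ℚ) * α j L = ∑ k ∈ Finset.range n, (g k : ℚ) * β k L) ∧
      (∀ j < m, ∀ k < n, Overlap p q j k → f j ≤ g k) ∧
      ∃ j < m, ∃ k < n, Overlap p q j k ∧ f j < g k := by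
  let W (t : ℕ) : Λ × (ℕ → ℚ) →ₗ[ℚ] ℚ := (LinearMap.proj t).comp (LinearMap.snd ℚ Λ (ℕ → ℚ))
  let E (p : ℕ → ℕ) (α : ℕ → Λ →ₗ[ℚ] ℚ) (j : ℕ) : Λ × (ℕ → ℚ) →ₗ[ℚ] ℚ :=
    ∑ t ∈ Finset.Ico (p j) (p (j + 1)), W t - (α j).comp (LinearMap.fst ℚ Λ (ℕ → ℚ))
  have hE : ∀ p α j (L : Λ) (w : ℕ → ℚ), E p α j (L, w) =
      ∑ t ∈ Finset.Ico (p j) (p (j + 1)), w t - α j L := fun p α j L w => by simp [E, W]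
  rcases gordan_alternative_of_eq (n := p m) (κ := Fin m ⊕ Fin n) (fun t => W t)
      (Sum.elim (fun j => E p α j) (fun k => E q β k)) with
    ⟨⟨L, w⟩, hw, he⟩ | ⟨c, d, hc, ⟨t₀, ht₀⟩, hsum⟩
  · refine Or.inl ⟨L, w, fun t ht => hw ⟨t, ht⟩, fun j hj => ?_, fun k hk => ?_⟩
    · have := he (Sum.inl ⟨j, hj⟩)
      simp only [Sum.elim_inl, hE] at this
      linarith
    · have := he (Sum.inr ⟨k, hk⟩)
      simp only [Sum.elim_inr, hE] at this
      linarith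
  right
  obtain ⟨N, hN, hint⟩ := exists_common_denominator Finset.univ d
  choose z hz using fun i => hint i (Finset.mem_univ i)
  have hN' : (0 : ℚ) < N := by exact_mod_cast hN
  let f : ℕ → ℤ := fun j => if h : j < m then - z (Sum.inl ⟨j, h⟩) else 0
  let g : ℕ → ℤ := fun k => if h : k < n then z (Sum.inr ⟨k, h⟩) else 0
  have hmain : ∀ (L : Λ) (w : ℕ → ℚ), (N : ℚ) * ∑ t : Fin (p m), c t * w t =
      - ∑ j ∈ Finset.range m, (f j : ℚ) *
        (∑ t ∈ Finset.Ico (p j) (p (j + 1)), w t - α j L) +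
      ∑ k ∈ Finset.range n, (g k : ℚ) *
        (∑ t ∈ Finset.Ico (q k) (q (k + 1)), w t - β k L) := by
    intro L w
    have h := hsum (L, w)
    simp only [Fintype.sum_sum_type, Sum.elim_inl, Sum.elim_inr, hE] at h
    have hW : ∀ t, W t (L, w) = w t := fun t => rfl
    simp only [hW] at h
    rw [h, Finset.sum_range, Finset.sum_range, mul_add, Finset.mul_sum, Finset.mul_sum,
      ← Finset.sum_neg_distrib]
    congr 1
    · refine Finset.sum_congr rfl fun j _ => ?_
      simp only [f, j.2, dif_pos]
      push_cast
      rw [← hz]; ring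
    · refine Finset.sum_congr rfl fun k _ => ?_
      simp only [g, k.2, dif_pos]
      rw [← hz]; ring
  have hcell : ∀ t (ht : t < p m), ∀ j < m, ∀ k < n, p j ≤ t → t < p (j + 1) → q k ≤ t →
      t < q (k + 1) → (N : ℚ) * c ⟨t, ht⟩ = g k - f j := by
    intro t ht j hj k hk h1 h2 h3 h4
    have h := hmain 0 (Pi.single t 1)
    simp only [map_zero, sub_zero] at h
    rw [sum_step_single hp (fun i => (f i : ℚ)) hj h1 h2,
      sum_step_single hq (fun i => (g i : ℚ)) hk h3 h4,
      Finset.sum_eq_single (⟨t, ht⟩ : Fin (p m))] at h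
    · simp at h; linarith
    · intro s _ hs
      have : (s : ℕ) ≠ t := fun h => hs (Fin.ext h)
      simp [this]
    · simp
  refine ⟨f, g, fun L => ?_, fun j hj k hk hov => ?_, ?_⟩
  · have := hmain L 0
    simp at this
    linarith
  · obtain ⟨o1, o2⟩ := hov
    have e1 := hp (a := j) (b := j + 1) (by simp; omega) (by simp; omega) (by omega)
    have e2 := hq (a := k) (b := k + 1) (by simp; omega) (by simp; omega) (by omega)
    have e3 := hp.monotoneOn (a := j + 1) (b := m) (by simp; omega) (by simp) (by omega)
    have h := hcell (max (p j) (q k)) (by omega) j hj k hk (by omega) (by omega) (by omega)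
      (by omega)
    have h' := mul_nonneg hN'.le (hc ⟨max (p j) (q k), by omega⟩)
    rw [h] at h'
    have : (f j : ℚ) ≤ g k := by linarith
    exact_mod_cast this
  · have hpos := mul_pos hN' ht₀
    by_cases hlow : p 0 ≤ t₀
    · obtain ⟨j, hj, h1, h2⟩ := exists_step_of_mem hlow t₀.2
      obtain ⟨k, hk, h3, h4⟩ := exists_step_of_mem (h0.symm.le.trans hlow)
        (t₀.2.trans_eq hmn)
      refine ⟨j, hj, k, hk, ⟨by omega, by omega⟩, ?_⟩
      have h : (N : ℚ) * c t₀ = g k - f j := hcell t₀ t₀.2 j hj k hk h1 h2 h3 h4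
      have : (f j : ℚ) < g k := by linarith
      exact_mod_cast this
    · exfalso
      have h := hmain 0 (Pi.single (t₀ : ℕ) 1)
      have hz : ∀ (r : ℕ → ℕ) (l i : ℕ), StrictMonoOn r (Set.Iic l) → r 0 = p 0 → i < l →
          ∑ s ∈ Finset.Ico (r i) (r (i + 1)), (Pi.single (t₀ : ℕ) 1 : ℕ → ℚ) s = 0 := by
        intro r l i hr hr0 hi
        have := hr.monotoneOn (a := 0) (b := i) (by simp) (by simp; omega) (by omega)
        rw [Finset.sum_pi_single', if_neg]
        simp; omega
      have s1 : ∑ j ∈ Finset.range m, (f j : ℚ) *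
          (∑ t ∈ Finset.Ico (p j) (p (j + 1)), (Pi.single (t₀ : ℕ) 1 : ℕ → ℚ) t - α j 0) = 0 :=
        Finset.sum_eq_zero fun j hj => by simp [hz p m j hp rfl (Finset.mem_range.1 hj)]
      have s2 : ∑ k ∈ Finset.range n, (g k : ℚ) *
          (∑ t ∈ Finset.Ico (q k) (q (k + 1)), (Pi.single (t₀ : ℕ) 1 : ℕ → ℚ) t - β k 0) = 0 :=
        Finset.sum_eq_zero fun k hk => by simp [hz q n k hq h0.symm (Finset.mem_range.1 hk)]
      rw [s1, s2, Finset.sum_eq_single t₀] at h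
      · simp at h; rcases h with h | h
        · omega
        · exact ht₀.ne' h
      · intro s _ hs
        have : (s : ℕ) ≠ t₀ := fun h => hs (Fin.ext h)
        simp [this]
      · simp

/-- If `S` is the set of steps of `p` all of whose overlapping steps of `q` lie in `T`, and the
weights respect all covers of runs of `S` by runs of `T`, then `S` weighs at most as much as `T`,
and strictly less unless the two sets have the same cells. -/
theorem sum_le_sum_of_covers {p q : ℕ → ℕ} {m n : ℕ} (hp : StrictMonoOn p (Set.Iic m))
    (hq : StrictMonoOn q (Set.Iic n)) (h0 : p 0 = q 0) (hmn : p m = q n) {S T : ℕ → Prop}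
    [DecidablePred S] [DecidablePred T]
    (hST : ∀ j < m, S j ↔ ∀ k < n, Overlap p q j k → T k) {a b : ℕ → ℕ}
    (hb : ∀ k < n, 0 < b k)
    (H : ∀ x x' y y', x ≤ x' → x' ≤ m → y ≤ y' → y' ≤ n → q y ≤ p x → p x' ≤ q y' →
      (∀ j, x ≤ j → j < x' → S j) → (∀ k, y ≤ k → k < y' → T k) →
      ∑ j ∈ Finset.Ico x x', a j ≤ ∑ k ∈ Finset.Ico y y', b k ∧
      (q y < p x ∨ p x' < q y' → ∑ j ∈ Finset.Ico x x', a j < ∑ k ∈ Finset.Ico y y', b k)) :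
    ∑ j ∈ Finset.range m with S j, a j ≤ ∑ k ∈ Finset.range n with T k, b k ∧
    ((∃ j < m, ∃ k < n, Overlap p q j k ∧ ¬ S j ∧ T k) →
      ∑ j ∈ Finset.range m with S j, a j < ∑ k ∈ Finset.range n with T k, b k) := by
  have pmono : ∀ {i j}, i ≤ j → j ≤ m → p i ≤ p j := fun h1 h2 =>
    hp.monotoneOn (by simp; omega) (by simpa using h2) h1
  have qmono : ∀ {i j}, i ≤ j → j ≤ n → q i ≤ q j := fun h1 h2 =>
    hq.monotoneOn (by simp; omega) (by simpa using h2) h1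
  have plt : ∀ {i j}, i < j → j ≤ m → p i < p j := fun h1 h2 =>
    hp (by simp; omega) (by simpa using h2) h1
  have qlt : ∀ {i j}, i < j → j ≤ n → q i < q j := fun h1 h2 =>
    hq (by simp; omega) (by simpa using h2) h1
  have main : ∀ y ≤ n,
      ∑ j ∈ Finset.range m with S j ∧ p (j + 1) ≤ q y, a j ≤
        ∑ k ∈ Finset.range y with T k, b k ∧
      ((∃ j < m, ∃ k < y, Overlap p q j k ∧ ¬ S j ∧ T k) →
        ∑ j ∈ Finset.range m with S j ∧ p (j + 1) ≤ q y, a j <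
          ∑ k ∈ Finset.range y with T k, b k) := by
    intro y
    induction y using Nat.strong_induction_on with
    | _ y ih =>
    intro hy
    rcases Nat.eq_zero_or_pos y with rfl | hy0
    · have : ({j ∈ Finset.range m | S j ∧ p (j + 1) ≤ q 0} : Finset ℕ) = ∅ := by
        ext j
        simp only [Finset.mem_filter, Finset.mem_range, Finset.notMem_empty, iff_false]
        rintro ⟨hj, -, h⟩
        have := plt (i := 0) (j := j + 1) (by omega) (by omega)
        omega
      rw [this]
      simp
    obtain ⟨y, rfl⟩ : ∃ y', y = y' + 1 := ⟨y - 1, by omega⟩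
    by_cases hT : T y
    swap
    · have e1 : ({j ∈ Finset.range m | S j ∧ p (j + 1) ≤ q (y + 1)} : Finset ℕ) =
          {j ∈ Finset.range m | S j ∧ p (j + 1) ≤ q y} := by
        ext j
        simp only [Finset.mem_filter, Finset.mem_range]
        refine and_congr_right fun hj => and_congr_right fun hS => ⟨fun h => ?_, fun h => ?_⟩
        · by_contra hlt
          have := plt (i := j) (j := j + 1) (by omega) (by omega)
          exact hT ((hST j hj).1 hS y (by omega) ⟨by omega, by omega⟩)
        · have := qmono (i := y) (j := y + 1) (by omega) (by omega)
          omega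
      have e2 : ({k ∈ Finset.range (y + 1) | T k} : Finset ℕ) = {k ∈ Finset.range y | T k} := by
        rw [Finset.range_add_one, Finset.filter_insert, if_neg hT]
      rw [e1, e2]
      refine ⟨(ih y (by omega) (by omega)).1, ?_⟩
      rintro ⟨j, hj, k, hk, ho, hS, hk'⟩
      refine (ih y (by omega) (by omega)).2 ⟨j, hj, k, ?_, ho, hS, hk'⟩
      have : k ≠ y := by rintro rfl; exact hT hk'
      omega
    · have hex : ∃ y₀, y₀ ≤ y ∧ ∀ k, y₀ ≤ k → k < y + 1 → T k :=
        ⟨y, le_rfl, fun k h1 h2 => by rwa [show k = y by omega]⟩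
      let y₀ := Nat.find hex
      obtain ⟨hy₀, hrun⟩ : y₀ ≤ y ∧ ∀ k, y₀ ≤ k → k < y + 1 → T k := Nat.find_spec hex
      have hmin : y₀ = 0 ∨ (0 < y₀ ∧ ¬ T (y₀ - 1)) := by
        rcases Nat.eq_zero_or_pos y₀ with h | h
        · exact Or.inl h
        · refine Or.inr ⟨h, fun hT' => ?_⟩
          refine Nat.find_min hex (m := y₀ - 1) (by omega) ⟨by omega, fun k h1 h2 => ?_⟩
          by_cases hk : k = y₀ - 1
          · rwa [hk]
          · exact hrun k (by omega) h2
      obtain ⟨ih1, ih2⟩ := ih y₀ (by omega) (by omega)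
      clear_value y₀
      have hqy := qlt (i := y₀) (j := y + 1) (by omega) hy
      have hqn := qmono (i := y + 1) (j := n) (by omega) le_rfl
      have hq0 := qmono (i := 0) (j := y₀) (by omega) (by omega)
      have hexx : ∃ x, q y₀ ≤ p x := ⟨m, by omega⟩
      let x := Nat.find hexx
      have hx : q y₀ ≤ p x := Nat.find_spec hexx
      have hxmin : ∀ i, i < x → p i < q y₀ := fun i hi => by
        have := Nat.find_min hexx hi; omega
      have hxm : x ≤ m := Nat.find_min' hexx (by omega)
      clear_value x
      let x' := Nat.findGreatest (fun i => p i ≤ q (y + 1)) m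
      have hx' : p x' ≤ q (y + 1) :=
        Nat.findGreatest_spec (P := fun i => p i ≤ q (y + 1)) (m := 0) (by omega)
          (by omega)
      have hx'm : x' ≤ m := Nat.findGreatest_le m
      have hx'max : ∀ i, x' < i → i ≤ m → q (y + 1) < p i := fun i h1 h2 => by
        have := Nat.findGreatest_is_greatest h1 h2; omega
      clear_value x'
      have hinS : ∀ j, x ≤ j → j < x' → S j := by
        intro j h1 h2
        refine (hST j (by omega)).2 fun k hk ho => hrun k ?_ ?_
        · by_contra hlt
          have := qmono (i := k + 1) (j := y₀) (by omega) (by omega)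
          have := pmono (i := x) (j := j) h1 (by omega)
          have := ho.1
          omega
        · by_contra hlt
          have := qmono (i := y + 1) (j := k) (by omega) (by omega)
          have := pmono (i := j + 1) (j := x') (by omega) (by omega)
          have := ho.2
          omega
      have e1 : ∑ j ∈ Finset.range m with S j ∧ p (j + 1) ≤ q (y + 1), a j =
          ∑ j ∈ Finset.range m with S j ∧ p (j + 1) ≤ q y₀, a j +
            ∑ j ∈ Finset.Ico x x', a j := by
        rw [← Finset.sum_union]
        · refine Finset.sum_congr ?_ fun _ _ => rfl
          ext j
          simp only [Finset.mem_filter, Finset.mem_range, Finset.mem_union, Finset.mem_Ico]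
          constructor
          · rintro ⟨hj, hS, h⟩
            by_cases hle : p (j + 1) ≤ q y₀
            · exact Or.inl ⟨hj, hS, hle⟩
            · right
              constructor
              · by_contra hlt
                have hlt := hxmin j (by omega)
                rcases hmin with h | ⟨h, hnT⟩
                · have := pmono (i := 0) (j := j) (by omega) (by omega)
                  rw [h] at hlt
                  omega
                · refine hnT ((hST j hj).1 hS (y₀ - 1) (by omega) ⟨?_, ?_⟩)
                  · rwa [Nat.sub_add_cancel h]
                  · have := qmono (i := y₀ - 1) (j := y₀) (by omega) (by omega)
                    omega
              · by_contra hlt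
                have := hx'max (j + 1) (by omega) (by omega)
                omega
          · rintro (⟨hj, hS, h⟩ | ⟨h1, h2⟩)
            · exact ⟨hj, hS, by omega⟩
            · refine ⟨by omega, hinS j h1 h2, ?_⟩
              have := pmono (i := j + 1) (j := x') (by omega) (by omega)
              omega
        · rw [Finset.disjoint_left]
          intro j hj hj'
          simp only [Finset.mem_filter, Finset.mem_range, Finset.mem_Ico] at hj hj'
          have := plt (i := x) (j := j + 1) (by omega) (by omega)
          omega
      have e2 : ∑ k ∈ Finset.range (y + 1) with T k, b k =
          ∑ k ∈ Finset.range y₀ with T k, b k + ∑ k ∈ Finset.Ico y₀ (y + 1), b k := by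
        rw [← Finset.sum_union]
        · refine Finset.sum_congr ?_ fun _ _ => rfl
          ext k
          simp only [Finset.mem_filter, Finset.mem_range, Finset.mem_union, Finset.mem_Ico]
          constructor
          · rintro ⟨h1, h2⟩
            by_cases h : k < y₀
            · exact Or.inl ⟨h, h2⟩
            · exact Or.inr ⟨by omega, h1⟩
          · rintro (⟨h1, h2⟩ | ⟨h1, h2⟩)
            · exact ⟨by omega, h2⟩
            · exact ⟨h2, hrun k h1 h2⟩
        · rw [Finset.disjoint_left]
          intro k hk hk'
          simp only [Finset.mem_filter, Finset.mem_range, Finset.mem_Ico] at hk hk'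
          omega
      have hcov : ∑ j ∈ Finset.Ico x x', a j ≤ ∑ k ∈ Finset.Ico y₀ (y + 1), b k ∧
          (q y₀ < p x ∨ p x' < q (y + 1) →
            ∑ j ∈ Finset.Ico x x', a j < ∑ k ∈ Finset.Ico y₀ (y + 1), b k) := by
        by_cases hxx : x ≤ x'
        · exact H x x' y₀ (y + 1) hxx hx'm (by omega) hy hx hx' hinS hrun
        · rw [Finset.Ico_eq_empty (a := x) (by omega), Finset.sum_empty]
          refine ⟨Nat.zero_le _, fun _ => ?_⟩
          exact Finset.sum_pos (fun k hk => hb k (by simp at hk; omega))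
            ⟨y, by simp; omega⟩
      rw [e1, e2]
      refine ⟨Nat.add_le_add ih1 hcov.1, ?_⟩
      rintro ⟨j, hj, k, hk, ho, hnS, hTk⟩
      by_cases hk0 : k < y₀
      · have := ih2 ⟨j, hj, k, hk0, ho, hnS, hTk⟩
        have := hcov.1
        omega
      · by_cases hstrict : q y₀ < p x ∨ p x' < q (y + 1)
        · have := hcov.2 hstrict
          omega
        · exfalso
          refine hnS (hinS j ?_ ?_)
          · by_contra hlt
            have := pmono (i := j + 1) (j := x) (by omega) (by omega)
            have := qmono (i := y₀) (j := k) (by omega) (by omega)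
            have := ho.2
            omega
          · by_contra hlt
            have := pmono (i := x') (j := j) (by omega) (by omega)
            have := qmono (i := k + 1) (j := y + 1) (by omega) (by omega)
            have := ho.1
            omega
  have hfin := main n le_rfl
  have e : ({j ∈ Finset.range m | S j ∧ p (j + 1) ≤ q n} : Finset ℕ) =
      {j ∈ Finset.range m | S j} := by
    refine Finset.filter_congr fun j hj => and_iff_left ?_
    rw [← hmn]
    exact pmono (by simpa using hj) le_rfl
  rwa [e] at hfin

theorem sum_toNat_mul_eq_sum_levels (f : ℕ → ℤ) (a : ℕ → ℕ) {m M : ℕ}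
    (hM : ∀ j < m, f j ≤ M) :
    ∑ j ∈ Finset.range m, (f j).toNat * a j =
      ∑ c ∈ Finset.range M, ∑ j ∈ Finset.range m with (c : ℤ) < f j, a j := by
  simp_rw [Finset.sum_filter]
  rw [Finset.sum_comm]
  refine Finset.sum_congr rfl fun j hj => ?_
  rw [← Finset.sum_filter, Finset.sum_const, smul_eq_mul]
  congr 1
  have := hM j (Finset.mem_range.1 hj)
  rw [← Finset.card_range (f j).toNat]
  congr 1
  ext c
  simp only [Finset.mem_filter, Finset.mem_range]
  omega

/-- Weighted version of `sum_le_sum_of_covers`, for the positive parts of step functions. -/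
theorem sum_toNat_mul_le_of_covers {p q : ℕ → ℕ} {m n : ℕ} (hp : StrictMonoOn p (Set.Iic m))
    (hq : StrictMonoOn q (Set.Iic n)) (h0 : p 0 = q 0) (hmn : p m = q n) {f g : ℕ → ℤ}
    (hle : ∀ j < m, ∀ k < n, Overlap p q j k → f j ≤ g k)
    (hatt : ∀ j < m, ∃ k < n, Overlap p q j k ∧ g k ≤ f j) {a b : ℕ → ℕ}
    (hb : ∀ k < n, 0 < b k)
    (H : ∀ x x' y y', x ≤ x' → x' ≤ m → y ≤ y' → y' ≤ n → q y ≤ p x → p x' ≤ q y' →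
      (∀ j, x ≤ j → j < x' → 0 < f j) → (∀ k, y ≤ k → k < y' → 0 < g k) →
      ∑ j ∈ Finset.Ico x x', a j ≤ ∑ k ∈ Finset.Ico y y', b k ∧
      (q y < p x ∨ p x' < q y' → ∑ j ∈ Finset.Ico x x', a j < ∑ k ∈ Finset.Ico y y', b k)) :
    ∑ j ∈ Finset.range m, (f j).toNat * a j ≤ ∑ k ∈ Finset.range n, (g k).toNat * b k ∧
    ((∃ j < m, ∃ k < n, Overlap p q j k ∧ f j < g k ∧ 0 < g k) →
      ∑ j ∈ Finset.range m, (f j).toNat * a j < ∑ k ∈ Finset.range n, (g k).toNat * b k) := by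
  let M := ∑ j ∈ Finset.range m, (f j).toNat + ∑ k ∈ Finset.range n, (g k).toNat
  have hMf : ∀ j < m, f j ≤ M := fun j hj => by
    have := Finset.single_le_sum (f := fun j => (f j).toNat) (s := Finset.range m)
      (fun _ _ => Nat.zero_le _) (Finset.mem_range.2 hj)
    omega
  have hMg : ∀ k < n, g k ≤ M := fun k hk => by
    have := Finset.single_le_sum (f := fun k => (g k).toNat) (s := Finset.range n)
      (fun _ _ => Nat.zero_le _) (Finset.mem_range.2 hk)
    omega
  have hlevel := fun c : ℕ => sum_le_sum_of_covers hp hq h0 hmn (S := fun j => (c : ℤ) < f j)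
    (T := fun k => (c : ℤ) < g k)
    (fun j hj => ⟨fun h k hk ho => h.trans_le (hle j hj k hk ho), fun h => by
      obtain ⟨k, hk, ho, hgf⟩ := hatt j hj
      exact (h k hk ho).trans_le hgf⟩) hb
    (fun x x' y y' h1 h2 h3 h4 h5 h6 h7 h8 => H x x' y y' h1 h2 h3 h4 h5 h6
      (fun j i1 i2 => by have := h7 j i1 i2; omega) (fun k i1 i2 => by have := h8 k i1 i2; omega))
  rw [sum_toNat_mul_eq_sum_levels f a hMf, sum_toNat_mul_eq_sum_levels g b hMg]
  refine ⟨Finset.sum_le_sum fun c _ => (hlevel c).1, ?_⟩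
  rintro ⟨j, hj, k, hk, ho, hlt, hpos⟩
  have := hMg k hk
  refine Finset.sum_lt_sum (fun c _ => (hlevel c).1)
    ⟨(g k - 1).toNat, Finset.mem_range.2 (by omega), (hlevel _).2 ⟨j, hj, k, hk, ho, ?_, ?_⟩⟩
  · omega
  · omega

/-- Any step functions `f ≤ g` can be tightened to step functions `f ≤ f' ≤ g' ≤ g` such that
`f'` is the largest step function below `g'` and `g'` is the smallest one above `f'`. -/
theorem exists_tight_steps {p q : ℕ → ℕ} {m n : ℕ} (hp : StrictMonoOn p (Set.Iic m))
    (hq : StrictMonoOn q (Set.Iic n)) (h0 : p 0 = q 0) (hmn : p m = q n) {f g : ℕ → ℤ}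
    (hle : ∀ j < m, ∀ k < n, Overlap p q j k → f j ≤ g k) :
    ∃ f' g' : ℕ → ℤ, (∀ j < m, f j ≤ f' j) ∧ (∀ k < n, g' k ≤ g k) ∧
      (∀ j < m, ∀ k < n, Overlap p q j k → f' j ≤ g' k) ∧
      (∀ j < m, ∃ k < n, Overlap p q j k ∧ g' k ≤ f' j) ∧
      (∀ k < n, ∃ j < m, Overlap p q j k ∧ g' k ≤ f' j) := by
  have hov : ∀ {p q : ℕ → ℕ} {m n : ℕ}, StrictMonoOn p (Set.Iic m) →
      p 0 = q 0 → p m = q n → ∀ j < m, ∃ k < n, Overlap p q j k := by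
    intro p q m n hp h0 hmn j hj
    have h1 := hp.monotoneOn (a := 0) (b := j) (by simp) (by simp; omega) (by omega)
    have h2 := hp (a := j) (b := j + 1) (by simp; omega) (by simp; omega) (by omega)
    have h3 := hp.monotoneOn (a := j + 1) (b := m) (by simp; omega) (by simp) (by omega)
    obtain ⟨k, hk, h4, h5⟩ := exists_step_of_mem (p := q) (m := n) (t := p j)
      (by omega) (by omega)
    exact ⟨k, hk, by omega, by omega⟩
  have hmin : ∀ j, ∃ k, j < m → k < n ∧ Overlap p q j k ∧
      ∀ k' < n, Overlap p q j k' → g k ≤ g k' := by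
    intro j
    by_cases hj : j < m
    · obtain ⟨k₀, hk₀, ho⟩ := hov hp h0 hmn j hj
      obtain ⟨k, hk, hk'⟩ := Finset.exists_min_image
        {k ∈ Finset.range n | Overlap p q j k} g ⟨k₀, by simp [hk₀, ho]⟩
      simp only [Finset.mem_filter, Finset.mem_range, and_imp] at hk hk'
      exact ⟨k, fun _ => ⟨hk.1, hk.2, hk'⟩⟩
    · exact ⟨0, fun h => absurd h hj⟩
  choose K hK using hmin
  have hmax : ∀ k, ∃ j, k < n → j < m ∧ Overlap p q j k ∧
      ∀ j' < m, Overlap p q j' k → g (K j') ≤ g (K j) := by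
    intro k
    by_cases hk : k < n
    · obtain ⟨j₀, hj₀, ho⟩ := hov hq h0.symm hmn.symm k hk
      obtain ⟨j, hj, hj'⟩ := Finset.exists_max_image
        {j ∈ Finset.range m | Overlap p q j k} (fun j => g (K j)) ⟨j₀, by simp [hj₀, ho.symm]⟩
      simp only [Finset.mem_filter, Finset.mem_range, and_imp] at hj hj'
      exact ⟨j, fun _ => ⟨hj.1, hj.2, hj'⟩⟩
    · exact ⟨0, fun h => absurd h hk⟩
  choose J hJ using hmax
  have hg' : ∀ k < n, g (K (J k)) ≤ g k := fun k hk =>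
    (hK (J k) (hJ k hk).1).2.2 k hk (hJ k hk).2.1
  refine ⟨fun j => g (K j), fun k => g (K (J k)), fun j hj => ?_, hg', fun j hj k hk ho => ?_,
    fun j hj => ?_, fun k hk => ?_⟩
  · exact hle j hj _ (hK j hj).1 (hK j hj).2.1
  · exact (hJ k hk).2.2 j hj ho
  · exact ⟨K j, (hK j hj).1, (hK j hj).2.1, hg' _ (hK j hj).1⟩
  · exact ⟨J k, (hJ k hk).1, (hJ k hk).2.1, le_rfl⟩

/-- A boundary order is represented by a rank function on the boundaries. -/
theorem BoundaryOrder.exists_rank {Y : Type*} {U₁ U₂ : List Y} {lt : BRel} (h : BoundaryOrder U₁ U₂ lt) :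
    ∃ r : ℕ × ℕ → ℕ, ∀ a b, EBoundary U₁ U₂ a → EBoundary U₁ U₂ b → (lt a b ↔ r a < r b) := by
  have hfin : {c | EBoundary U₁ U₂ c}.Finite := by
    refine (Set.finite_Iic ((2 : ℕ), U₁.length + U₂.length)).subset ?_
    rintro ⟨i, j⟩ ⟨hi, hj⟩
    simp only at hi hj
    refine Prod.mk_le_mk.2 ⟨by omega, hj.trans ?_⟩
    unfold word
    split <;> omega
  have hlower : ∀ b, {c | EBoundary U₁ U₂ c ∧ lt c b}.Finite := fun b =>
    hfin.subset fun c hc => hc.1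
  have hmono : ∀ a b, EBoundary U₁ U₂ a → EBoundary U₁ U₂ b → lt a b →
      {c | EBoundary U₁ U₂ c ∧ lt c a}.ncard < {c | EBoundary U₁ U₂ c ∧ lt c b}.ncard := by
    intro a b ha hb hab
    refine Set.ncard_lt_ncard ⟨fun c hc => ⟨hc.1, h.trans c a b hc.1 ha hb hc.2 hab⟩, fun hsub => ?_⟩
      (hlower b)
    exact h.irrefl a ha (hsub ⟨ha, hab⟩).2
  have hincomp : ∀ a b, EBoundary U₁ U₂ a → EBoundary U₁ U₂ b → Incomp lt a b →
      ∀ c, EBoundary U₁ U₂ c → lt c a → lt c b := by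
    intro a b ha hb hab c hc hca
    by_contra hcb
    by_cases hbc : lt b c
    · exact hab.2 (h.trans b c a hb hc ha hbc hca)
    · exact (h.incomp_trans a b c ha hb hc hab ⟨hbc, hcb⟩).2 hca
  refine ⟨fun b => {c | EBoundary U₁ U₂ c ∧ lt c b}.ncard, fun a b ha hb =>
    ⟨hmono a b ha hb, fun hlt => ?_⟩⟩
  by_contra hab
  by_cases hba : lt b a
  · exact absurd hlt (hmono b a hb ha hba).not_gt
  · have : {c | EBoundary U₁ U₂ c ∧ lt c a} = {c | EBoundary U₁ U₂ c ∧ lt c b} := by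
      ext c
      exact and_congr_right fun hc => ⟨hincomp a b ha hb ⟨hab, hba⟩ c hc,
        hincomp b a hb ha ⟨hba, hab⟩ c hc⟩
    simp [this] at hlt

theorem sum_map_take {Y : Type*} (U : List Y) (L : Y → ℕ) (k : ℕ) :
    ((U.take k).map L).sum = ∑ i ∈ Finset.range k, U[i]?.elim 0 L := by
  induction k with
  | zero => simp
  | succ k ih =>
    rw [Finset.sum_range_succ, ← ih, List.take_add_one]
    cases U[k]? <;> simp

theorem sum_map_drop_take {Y : Type*} (U : List Y) (L : Y → ℕ) {y k : ℕ} (h : y ≤ k) :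
    (((U.take k).drop y).map L).sum = ∑ i ∈ Finset.Ico y k, U[i]?.elim 0 L := by
  have h1 : ((U.take k).map L).sum =
      ((U.take y).map L).sum + (((U.take k).drop y).map L).sum := by
    conv_lhs => rw [← List.take_append_drop y (U.take k)]
    rw [List.map_append, List.sum_append, List.take_take, min_eq_left h]
  rw [sum_map_take, sum_map_take, ← Finset.sum_range_add_sum_Ico _ h] at h1
  omega

theorem sum_map_take_eq_sum_cells {Y : Type*} {U : List Y} {L : Y → ℕ} {p : ℕ → ℕ} {w : ℕ → ℚ}
    (hp : StrictMonoOn p (Set.Iic U.length))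
    (h : ∀ j, ∀ hj : j < U.length, ∑ t ∈ Finset.Ico (p j) (p (j + 1)), w t = L U[j]) :
    ∀ j ≤ U.length, (((U.take j).map L).sum : ℚ) = ∑ t ∈ Finset.Ico (p 0) (p j), w t := by
  intro j
  induction j with
  | zero => simp
  | succ j ih =>
    intro hj
    have h1 := hp.monotoneOn (a := 0) (b := j) (by simp) (by simp; omega) (by omega)
    have h2 := hp.monotoneOn (a := j) (b := j + 1) (by simp; omega) (by simpa using hj) (by omega)
    rw [← Finset.sum_Ico_consecutive _ h1 h2, ← ih (by omega), h j hj,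
      List.take_add_one, List.getElem?_eq_getElem hj, List.map_append, List.sum_append]
    simp only [Option.toList_some, List.map_singleton, List.sum_singleton, Nat.cast_add]

theorem coherent_of_weights {U₁ U₂ : List X} {lt : BRel} {r : ℕ × ℕ → ℕ}
    (hr : ∀ a b, EBoundary U₁ U₂ a → EBoundary U₁ U₂ b → (lt a b ↔ r a < r b))
    (hp : StrictMonoOn (fun j => r (1, j)) (Set.Iic U₁.length))
    (hq : StrictMonoOn (fun k => r (2, k)) (Set.Iic U₂.length))
    (h0 : r (1, 0) = r (2, 0)) (hmn : r (1, U₁.length) = r (2, U₂.length))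
    {L : X → ℚ} {w : ℕ → ℚ} (hw : ∀ t < r (1, U₁.length), 0 < w t)
    (h1 : ∀ j, ∀ hj : j < U₁.length,
      ∑ t ∈ Finset.Ico (r (1, j)) (r (1, j + 1)), w t = L U₁[j])
    (h2 : ∀ k, ∀ hk : k < U₂.length,
      ∑ t ∈ Finset.Ico (r (2, k)) (r (2, k + 1)), w t = L U₂[k]) :
    Coherent U₁ U₂ lt := by
  obtain ⟨N, hN, hz⟩ := exists_common_denominator (U₁ ++ U₂).toFinset L
  have hN' : (0 : ℚ) < N := by exact_mod_cast hN
  have hsumpos : ∀ {s t : ℕ}, s < t → t ≤ r (1, U₁.length) → 0 < ∑ i ∈ Finset.Ico s t, w i :=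
    fun h h' => Finset.sum_pos (fun i hi => hw i (by simp at hi; omega)) (by simpa using h)
  have hpos : ∀ x ∈ (U₁ ++ U₂).toFinset, 0 < L x := by
    intro x hx
    rw [List.mem_toFinset, List.mem_append] at hx
    rcases hx with hx | hx <;> obtain ⟨j, hj, rfl⟩ := List.getElem_of_mem hx
    · rw [← h1 j hj]
      exact hsumpos (hp (by simp; omega) (by simp; omega) (by omega))
        (hp.monotoneOn (by simp; omega) (by simp) (by omega))
    · rw [← h2 j hj]
      exact hsumpos (hq (by simp; omega) (by simp; omega) (by omega))
        (hmn ▸ hq.monotoneOn (by simp; omega) (by simp) (by omega))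
  have hnat : ∀ x, ∃ l : ℕ, 0 < l ∧ (x ∈ (U₁ ++ U₂).toFinset → (l : ℚ) = N * L x) := by
    intro x
    by_cases hx : x ∈ (U₁ ++ U₂).toFinset
    · obtain ⟨z, hz⟩ := hz x hx
      have hzpos : 0 < z := by
        have := mul_pos hN' (hpos x hx)
        rw [hz] at this
        exact_mod_cast this
      obtain ⟨l, rfl⟩ := Int.eq_ofNat_of_zero_le hzpos.le
      exact ⟨l, by omega, fun _ => by rw [hz]; simp⟩
    · exact ⟨1, one_pos, fun h => absurd h hx⟩
  choose l hlpos hl using hnat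
  have e1 := sum_map_take_eq_sum_cells (L := l) (w := fun t => N * w t) hp fun j hj => by
    rw [hl _ (by simp), ← h1 j hj, Finset.mul_sum]
  have e2 := sum_map_take_eq_sum_cells (L := l) (w := fun t => N * w t) hq fun k hk => by
    rw [hl _ (by simp), ← h2 k hk, Finset.mul_sum]
  have hpre : ∀ a, EBoundary U₁ U₂ a → r a ≤ r (1, U₁.length) ∧ r (1, 0) ≤ r a ∧
      (prefixLen U₁ U₂ l a : ℚ) = N * ∑ t ∈ Finset.Ico (r (1, 0)) (r a), w t := by
    rintro ⟨i, j⟩ ⟨hi, hj⟩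
    simp only at hi
    rcases hi with rfl | rfl
    · simp only [word, if_true] at hj
      refine ⟨hp.monotoneOn (by simpa using hj) (by simp) hj,
        hp.monotoneOn (by simp) (by simpa using hj) (Nat.zero_le j), ?_⟩
      rw [Finset.mul_sum, ← e1 j hj]
      simp [prefixLen, word]
    · simp only [word, OfNat.ofNat_ne_one, if_false] at hj
      refine ⟨hmn ▸ hq.monotoneOn (by simpa using hj) (by simp) hj,
        h0 ▸ hq.monotoneOn (by simp) (by simpa using hj) (Nat.zero_le j), ?_⟩
      rw [Finset.mul_sum, h0, ← e2 j hj]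
      simp [prefixLen, word]
  have hlt : ∀ a b, EBoundary U₁ U₂ a → EBoundary U₁ U₂ b → r a < r b →
      prefixLen U₁ U₂ l a < prefixLen U₁ U₂ l b := by
    intro a b ha hb hab
    obtain ⟨-, a2, a3⟩ := hpre a ha
    obtain ⟨b1, -, b3⟩ := hpre b hb
    have hs := mul_pos hN' (hsumpos hab b1)
    rw [← Finset.sum_Ico_consecutive _ a2 hab.le] at b3
    have : (prefixLen U₁ U₂ l a : ℚ) < prefixLen U₁ U₂ l b := by rw [a3, b3]; linarith
    exact_mod_cast this
  refine ⟨l, hlpos, fun a b ha hb => ?_⟩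
  have ha : EBoundary U₁ U₂ a := ⟨ha.1, ha.2.2⟩
  have hb : EBoundary U₁ U₂ b := ⟨hb.1, hb.2.2⟩
  rw [hr a b ha hb]
  refine ⟨hlt a b ha hb, fun h => ?_⟩
  by_contra hab
  rcases (not_lt.1 hab).lt_or_eq with h' | h'
  · exact absurd (hlt b a hb ha h') h.not_gt
  · have : (prefixLen U₁ U₂ l a : ℚ) = prefixLen U₁ U₂ l b := by
      rw [(hpre a ha).2.2, (hpre b hb).2.2, h']
    have : prefixLen U₁ U₂ l a = prefixLen U₁ U₂ l b := by exact_mod_cast this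
    omega

theorem elim_pos {Y : Type*} {U : List Y} {L : Y → ℕ} (hL : ∀ x, 0 < L x) {j : ℕ} (hj : j < U.length) :
    0 < U[j]?.elim 0 L := by
  rw [List.getElem?_eq_getElem hj]
  exact hL _

theorem segL_mk {Y : Type*} {U₁ U₂ : List Y} {L : Y → ℕ} {i y y' : ℕ} (h : y ≤ y') :
    segL U₁ U₂ L ⟨i, y + 1, y'⟩ = ∑ k ∈ Finset.Ico y y', (word U₁ U₂ i)[k]?.elim 0 L :=
  sum_map_drop_take _ L h

/-- The covers whose intervals lie in the positive (on side 1) or negative (on side 2) part of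
the given step functions. -/
def signedCovers (U₁ U₂ : List X) (lt : BRel) (f g : ℕ → ℤ) : Set (Seg × Seg) :=
  {s | IsCover U₁ U₂ lt s.1 s.2 ∧
    ((s.1.i = 1 ∧ s.2.i = 2 ∧ (∀ j, s.1.j ≤ j + 1 → j + 1 ≤ s.1.k → 0 < f j) ∧
      ∀ k, s.2.j ≤ k + 1 → k + 1 ≤ s.2.k → 0 < g k) ∨
    (s.1.i = 2 ∧ s.2.i = 1 ∧ (∀ k, s.1.j ≤ k + 1 → k + 1 ≤ s.1.k → g k < 0) ∧
      ∀ j, s.2.j ≤ j + 1 → j + 1 ≤ s.2.k → f j < 0))}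

theorem not_impinges_of_mem_signedCovers {Y : Type*} {U₁ U₂ : List Y} {lt : BRel} {f g : ℕ → ℤ}
    {s t : Seg × Seg} (hs : s ∈ signedCovers U₁ U₂ lt f g) (ht : t ∈ signedCovers U₁ U₂ lt f g) :
    ¬ Impinges s t := by
  rintro ⟨⟨i, l⟩, ⟨b1, b2, b3⟩, ⟨b4, b5, b6⟩⟩
  simp only at b1 b2 b3 b4 b5 b6
  have hl : 1 ≤ l := hs.1.2.1.2.1.trans b2
  obtain ⟨l, rfl⟩ : ∃ l', l = l' + 1 := ⟨l - 1, by omega⟩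
  rcases hs.2 with ⟨-, h1, -, h2⟩ | ⟨-, h1, -, h2⟩ <;>
    rcases ht.2 with ⟨h3, -, h4, -⟩ | ⟨h3, -, h4, -⟩
  · omega
  · exact absurd (h2 l b2 b3) (h4 l b5 b6).not_gt
  · exact absurd (h2 l b2 b3) (h4 l b5 b6).not_gt
  · omega

/-- A length assignment compatible with a set of covers compares the two intervals of any
of its covers, given by ranks. -/
theorem sum_le_sum_of_isCover {Y : Type*} {U₁ U₂ : List Y} {lt : BRel} {r : ℕ × ℕ → ℕ}
    (hr : ∀ a b, EBoundary U₁ U₂ a → EBoundary U₁ U₂ b → (lt a b ↔ r a < r b))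
    {i i' : ℕ} (hi : i = 1 ∨ i = 2) (hi' : i' = 1 ∨ i' = 2) (hii : i ≠ i') {x x' y y' : ℕ}
    (hx : x ≤ x') (hx' : x' ≤ (word U₁ U₂ i).length) (hy : y ≤ y')
    (hy' : y' ≤ (word U₁ U₂ i').length) (h1 : r (i', y) ≤ r (i, x))
    (h2 : r (i, x') ≤ r (i', y')) {C : Set (Seg × Seg)}
    (hC : IsCover U₁ U₂ lt ⟨i, x + 1, x'⟩ ⟨i', y + 1, y'⟩ →
      ((⟨i, x + 1, x'⟩, ⟨i', y + 1, y'⟩) : Seg × Seg) ∈ C) {L : Y → ℕ}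
    (hle : ∀ p ∈ C, segL U₁ U₂ L p.1 ≤ segL U₁ U₂ L p.2)
    (hlt : ∀ p ∈ C, IsStrictCover U₁ U₂ lt p.1 p.2 → segL U₁ U₂ L p.1 < segL U₁ U₂ L p.2) :
    ∑ j ∈ Finset.Ico x x', (word U₁ U₂ i)[j]?.elim 0 L ≤
      ∑ k ∈ Finset.Ico y y', (word U₁ U₂ i')[k]?.elim 0 L ∧
    (r (i', y) < r (i, x) ∨ r (i, x') < r (i', y') →
      ∑ j ∈ Finset.Ico x x', (word U₁ U₂ i)[j]?.elim 0 L <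
        ∑ k ∈ Finset.Ico y y', (word U₁ U₂ i')[k]?.elim 0 L) := by
  have ex : EBoundary U₁ U₂ (i, x) := ⟨hi, hx.trans hx'⟩
  have ex' : EBoundary U₁ U₂ (i, x') := ⟨hi, hx'⟩
  have ey : EBoundary U₁ U₂ (i', y) := ⟨hi', hy.trans hy'⟩
  have ey' : EBoundary U₁ U₂ (i', y') := ⟨hi', hy'⟩
  have hLeS : ∀ a b, EBoundary U₁ U₂ a → EBoundary U₁ U₂ b → r a ≤ r b → LeS lt a b := by
    intro a b ha hb hab
    rcases hab.lt_or_eq with h | h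
    · exact Or.inl ((hr a b ha hb).2 h)
    · refine Or.inr ⟨?_, ?_⟩
      · rw [hr a b ha hb]; omega
      · rw [hr b a hb ha]; omega
  have hcov : IsCover U₁ U₂ lt ⟨i, x + 1, x'⟩ ⟨i', y + 1, y'⟩ :=
    ⟨⟨hi, by simp, by simpa using hx, hx'⟩, ⟨hi', by simp, by simpa using hy, hy'⟩, hii,
      hLeS _ _ ey ex h1, hLeS _ _ ex' ey' h2⟩
  rw [← segL_mk hx, ← segL_mk hy]
  refine ⟨hle _ (hC hcov), fun h => hlt _ (hC hcov) ⟨hcov, ?_⟩⟩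
  exact h.imp (hr _ _ ey ex).2 (hr _ _ ex' ey').2

/-- **Lemma.** Every incoherent extended word equation has an incoherent core in
which no cover impinges on another. -/
theorem exists_nonimpinging_incoherent_core (U₁ U₂ : List X) (lt : BRel)
    (hbo : BoundaryOrder U₁ U₂ lt) (hinc : ¬ Coherent U₁ U₂ lt) :
    ∃ C : Set (Seg × Seg), IncoherentCore U₁ U₂ lt C ∧
      ∀ p ∈ C, ∀ q ∈ C, p ≠ q → ¬ Impinges p q := by
  obtain ⟨r, hr⟩ := hbo.exists_rank
  have w1 : word U₁ U₂ 1 = U₁ := rfl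
  have w2 : word U₁ U₂ 2 = U₂ := rfl
  have hstrict : ∀ i, i = 1 ∨ i = 2 →
      StrictMonoOn (fun j => r (i, j)) (Set.Iic (word U₁ U₂ i).length) := by
    intro i hi
    refine strictMonoOn_of_lt_add_one Set.ordConnected_Iic fun j _ hj hj' => ?_
    exact (hr (i, j) (i, j + 1) ⟨hi, hj⟩ ⟨hi, hj'⟩).1 (hbo.succ i j ⟨hi, hj'⟩)
  have hp : StrictMonoOn (fun j => r (1, j)) (Set.Iic U₁.length) := hstrict 1 (Or.inl rfl)
  have hq : StrictMonoOn (fun k => r (2, k)) (Set.Iic U₂.length) := hstrict 2 (Or.inr rfl)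
  have hinceq : ∀ a b, EBoundary U₁ U₂ a → EBoundary U₁ U₂ b → Incomp lt a b → r a = r b := by
    intro a b ha hb ⟨h1, h2⟩
    rw [hr _ _ ha hb] at h1
    rw [hr _ _ hb ha] at h2
    omega
  have h0 : r (1, 0) = r (2, 0) :=
    hinceq _ _ ⟨Or.inl rfl, Nat.zero_le _⟩ ⟨Or.inr rfl, Nat.zero_le _⟩ hbo.bot
  have hmn : r (1, U₁.length) = r (2, U₂.length) :=
    hinceq _ _ ⟨Or.inl rfl, le_rfl⟩ ⟨Or.inr rfl, le_rfl⟩ hbo.top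
  let α (U : List X) (j : ℕ) : (X → ℚ) →ₗ[ℚ] ℚ := U[j]?.elim 0 LinearMap.proj
  have hα : ∀ (U : List X) (L : X → ℚ) j, ∀ hj : j < U.length, α U j L = L U[j] := by
    intro U L j hj
    simp [α, List.getElem?_eq_getElem hj]
  rcases weights_or_certificate hp hq h0 hmn (α U₁) (α U₂) with
    ⟨L, w, hw, h1, h2⟩ | ⟨f, g, hsum, hle, hlt⟩
  · refine absurd (coherent_of_weights hr hp hq h0 hmn (L := L) hw (fun j hj => ?_)
      fun k hk => ?_) hinc
    · rw [← hα U₁ L j hj]; exact h1 j hj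
    · rw [← hα U₂ L k hk]; exact h2 k hk
  obtain ⟨f', g', hff, hgg, hle', hf, hg⟩ := exists_tight_steps hp hq h0 hmn hle
  refine ⟨signedCovers U₁ U₂ lt f' g', ⟨fun s hs => hs.1, ?_⟩,
    fun s hs t ht _ => not_impinges_of_mem_signedCovers hs ht⟩
  rintro ⟨L, hL, hCle, hClt⟩
  let a (U : List X) (j : ℕ) : ℕ := U[j]?.elim 0 L
  have hpos := sum_toNat_mul_le_of_covers hp hq h0 hmn hle' hf (a := a U₁) (b := a U₂)
    (fun k hk => elim_pos hL hk) fun x x' y y' i1 i2 i3 i4 i5 i6 i7 i8 =>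
      sum_le_sum_of_isCover hr (C := signedCovers U₁ U₂ lt f' g') (i := 1) (i' := 2) (by simp) (by simp)
        (by simp) i1 i2 i3 i4 i5 i6
        (fun hc => ⟨hc, Or.inl ⟨rfl, rfl, fun j j1 j2 => i7 j (by simpa using j1) j2,
          fun k k1 k2 => i8 k (by simpa using k1) k2⟩⟩) hCle hClt
  have hneg := sum_toNat_mul_le_of_covers hq hp h0.symm hmn.symm
    (f := fun k => - g' k) (g := fun j => - f' j) (a := a U₂) (b := a U₁)
    (fun k hk j hj ho => neg_le_neg (hle' j hj k hk ho.symm))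
    (fun k hk => by
      obtain ⟨j, hj, ho, h⟩ := hg k hk
      exact ⟨j, hj, ho.symm, neg_le_neg h⟩)
    (fun j hj => elim_pos hL hj) fun x x' y y' i1 i2 i3 i4 i5 i6 i7 i8 =>
      sum_le_sum_of_isCover hr (C := signedCovers U₁ U₂ lt f' g') (i := 2) (i' := 1) (by simp) (by simp)
        (by simp) i1 i2 i3 i4 i5 i6
        (fun hc => ⟨hc, Or.inr ⟨rfl, rfl,
          fun k k1 k2 => neg_pos.1 (i7 k (by simpa using k1) k2),
          fun j j1 j2 => neg_pos.1 (i8 j (by simpa using j1) j2)⟩⟩) hCle hClt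
  have hsplit : ∀ (U : List X) (f : ℕ → ℤ) (m : ℕ), ∑ j ∈ Finset.range m, f j * (a U j : ℤ) =
      ((∑ j ∈ Finset.range m, (f j).toNat * a U j : ℕ) : ℤ) -
        ((∑ j ∈ Finset.range m, (- f j).toNat * a U j : ℕ) : ℤ) := by
    intro U f m
    push_cast
    rw [← Finset.sum_sub_distrib]
    refine Finset.sum_congr rfl fun j _ => ?_
    rw [← sub_mul, Int.toNat_sub_toNat_neg]
  have hbal : ∑ j ∈ Finset.range U₁.length, f j * (a U₁ j : ℤ) =
      ∑ k ∈ Finset.range U₂.length, g k * (a U₂ k : ℤ) := by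
    have h := hsum fun x => (L x : ℚ)
    have hc : ∀ (U : List X) j, α U j (fun x => (L x : ℚ)) = (a U j : ℚ) := by
      intro U j
      simp only [α, a]
      cases U[j]? <;> simp
    simp only [hc] at h
    exact_mod_cast h
  have hfmono : ∀ j ∈ Finset.range U₁.length, f j * (a U₁ j : ℤ) ≤ f' j * (a U₁ j : ℤ) :=
    fun j hj => mul_le_mul_of_nonneg_right (hff j (Finset.mem_range.1 hj)) (by positivity)
  have hgmono : ∀ k ∈ Finset.range U₂.length, g' k * (a U₂ k : ℤ) ≤ g k * (a U₂ k : ℤ) :=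
    fun k hk => mul_le_mul_of_nonneg_right (hgg k (Finset.mem_range.1 hk)) (by positivity)
  have hfs := Finset.sum_le_sum hfmono
  have hgs := Finset.sum_le_sum hgmono
  have s1 := hsplit U₁ f' U₁.length
  have s2 := hsplit U₂ g' U₂.length
  obtain ⟨hpos1, hpos2⟩ := hpos
  obtain ⟨hneg1, hneg2⟩ := hneg
  obtain ⟨j, hj, k, hk, ho, hjk⟩ := hlt
  by_cases hne : f' j < g' k
  · by_cases hgk : 0 < g' k
    · have := hpos2 ⟨j, hj, k, hk, ho, hne, hgk⟩
      omega
    · have := hneg2 ⟨k, hk, j, hj, ho.symm, by omega, by omega⟩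
      omega
  · by_cases hfj : f j < f' j
    · have := Finset.sum_lt_sum hfmono ⟨j, Finset.mem_range.2 hj,
        mul_lt_mul_of_pos_right hfj (by exact_mod_cast elim_pos hL hj)⟩
      omega
    · have hgk : g' k < g k := by omega
      have := Finset.sum_lt_sum hgmono ⟨k, Finset.mem_range.2 hk,
        mul_lt_mul_of_pos_right hgk (by exact_mod_cast elim_pos hL hk)⟩
      omega

end ExtWordEq
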